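/- arXiv:1010.5719 — 2 statements merged into one kernel-verified Lean document; each statement's English description precedes it below -/
import Mathlib

section
/- For every integer n ≥ 2, let π̃_n be the labeled permutation on the alphabet {0,1,…,n} whose top row is 0, 2, 3, …, n−1, 1, n and whose bottom row is n, n−1, …, 2, 1, 0; that is, π_t(0) = 1, π_t(j) = j for 2 ≤ j ≤ n−1, π_t(1) = n, π_t(n) = n+1, and π_b(j) = n+1−j for 0 ≤ j ≤ n. Then the labeled Rauzy class R_lab(π̃_n) is finite and has cardinality (2^(n−1) − 1 + n)·(n−1). -/
/-!
A labeled permutation on a finite alphabet `A` with `|A| = d` is a pair of bijections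
`A ≃ Fin d`, where the index `j - 1 : Fin d` corresponds to the position `j ∈ {1,…,d}`.
The labeled Rauzy moves are encoded as binary relations.
-/

/-- The labeled top Rauzy move `𝓡_t`, as a relation. -/
def labStepT {A : Type*} {d : ℕ} (p p' : (A ≃ Fin d) × (A ≃ Fin d)) : Prop :=
  ∀ last : Fin d, (last : ℕ) + 1 = d →
    p.1.symm last ≠ p.2.symm last ∧ p'.1 = p.1 ∧
    ∀ j : Fin d,
      ((j : ℕ) ≤ (p.2 (p.1.symm last) : ℕ) → p'.2.symm j = p.2.symm j) ∧
      ((j : ℕ) = (p.2 (p.1.symm last) : ℕ) + 1 → p'.2.symm j = p.2.symm last) ∧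
      ((p.2 (p.1.symm last) : ℕ) + 1 < (j : ℕ) →
        ∀ i : Fin d, (i : ℕ) + 1 = (j : ℕ) → p'.2.symm j = p.2.symm i)

/-- The labeled bottom Rauzy move `𝓡_b`, as a relation. -/
def labStepB {A : Type*} {d : ℕ} (p p' : (A ≃ Fin d) × (A ≃ Fin d)) : Prop :=
  ∀ last : Fin d, (last : ℕ) + 1 = d →
    p.1.symm last ≠ p.2.symm last ∧ p'.2 = p.2 ∧
    ∀ j : Fin d,
      ((j : ℕ) ≤ (p.1 (p.2.symm last) : ℕ) → p'.1.symm j = p.1.symm j) ∧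
      ((j : ℕ) = (p.1 (p.2.symm last) : ℕ) + 1 → p'.1.symm j = p.1.symm last) ∧
      ((p.1 (p.2.symm last) : ℕ) + 1 < (j : ℕ) →
        ∀ i : Fin d, (i : ℕ) + 1 = (j : ℕ) → p'.1.symm j = p.1.symm i)

/-- The labeled Rauzy class of `p`. -/
def labRauzyClass {A : Type*} {d : ℕ} (p : (A ≃ Fin d) × (A ≃ Fin d)) :
    Set ((A ≃ Fin d) × (A ≃ Fin d)) :=
  {q | Relation.ReflTransGen (fun a b => labStepT a b ∨ labStepB a b) p q}

/-! ### Rauzy moves on rows -/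

namespace RauzyRows

set_option linter.unusedSectionVars false

variable {α : Type*} [DecidableEq α]

/-- Rotate by one step to the right the part of a row that follows the letter `a`. -/
def rotAfter (a : α) : List α → List α
  | [] => []
  | x :: l => if x = a then x :: l.rotate (l.length - 1) else x :: rotAfter a l

/-- The number of letters that follow the letter `a` in a row. -/
def tailLen (a : α) : List α → ℕ
  | [] => 0
  | x :: l => if x = a then l.length else tailLen a l

/-- The Rauzy move in which the last letter of row `s` wins, acting on a pair of rows
(`true` is the top row, `false` the bottom row). -/
def move (s : Bool) (p : Bool → List α) : Bool → List α := fun b =>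
  if b = s then p b else (p s).getLast?.elim (p b) (fun a => rotAfter a (p b))

/-- The length of the orbit of `p` under `move s`. -/
def period (s : Bool) (p : Bool → List α) : ℕ :=
  (p s).getLast?.elim 0 (fun a => tailLen a (p (!s)))

lemma rotAfter_append {a : α} {Y : List α} (h : a ∉ Y) (Z : List α) :
    rotAfter a (Y ++ a :: Z) = Y ++ a :: Z.rotate (Z.length - 1) := by
  induction Y with
  | nil => simp [rotAfter]
  | cons x Y ih =>
    simp only [List.mem_cons, not_or] at h
    simp [rotAfter, Ne.symm h.1, ih h.2]

lemma rotAfter_append_concat {a : α} {Y : List α} (h : a ∉ Y) (Z : List α) (b : α) :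
    rotAfter a (Y ++ a :: (Z ++ [b])) = Y ++ a :: b :: Z := by
  simp [rotAfter_append h]

lemma rotAfter_of_notMem {a : α} {Y : List α} (h : a ∉ Y) : rotAfter a Y = Y := by
  induction Y with
  | nil => simp [rotAfter]
  | cons x Y ih =>
    simp only [List.mem_cons, not_or] at h
    simp [rotAfter, Ne.symm h.1, ih h.2]

lemma tailLen_append {a : α} {Y : List α} (h : a ∉ Y) (Z : List α) :
    tailLen a (Y ++ a :: Z) = Z.length := by
  induction Y with
  | nil => simp [tailLen]
  | cons x Y ih =>
    simp only [List.mem_cons, not_or] at h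
    simp [tailLen, Ne.symm h.1, ih h.2]

lemma tailLen_of_notMem {a : α} {Y : List α} (h : a ∉ Y) : tailLen a Y = 0 := by
  induction Y with
  | nil => simp [tailLen]
  | cons x Y ih =>
    simp only [List.mem_cons, not_or] at h
    simp [tailLen, Ne.symm h.1, ih h.2]

lemma rotAfter_perm (a : α) (l : List α) : (rotAfter a l).Perm l := by
  induction l with
  | nil => simp [rotAfter]
  | cons x l ih =>
    unfold rotAfter
    split
    · exact (List.rotate_perm _ _).cons _
    · exact ih.cons _

lemma rotAfter_injective (a : α) : Function.Injective (rotAfter a) := by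
  intro l
  induction l with
  | nil =>
    intro l' h
    have := (rotAfter_perm a l').length_eq
    rw [← h] at this
    exact (List.length_eq_zero_iff.1 (by simpa [rotAfter] using this.symm)).symm
  | cons x l ih =>
    intro l' h
    cases l' with
    | nil =>
      have := (rotAfter_perm a (x :: l)).length_eq
      rw [h] at this
      simp [rotAfter] at this
    | cons x' l' =>
      have hl := (rotAfter_perm a (x :: l)).length_eq.symm.trans
        ((congrArg List.length h).trans (rotAfter_perm a (x' :: l')).length_eq)
      simp only [List.length_cons, Nat.add_right_cancel_iff] at hl
      unfold rotAfter at h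
      have hx : x = x' := by
        split at h <;> split at h <;> exact (List.cons.inj h).1
      subst hx
      split at h
      · rw [hl] at h
        rw [List.rotate_injective _ (List.cons.inj h).2]
      · rw [ih (List.cons.inj h).2]

lemma rotAfter_iterate {a : α} {Y : List α} (h : a ∉ Y) (A B : List α) :
    (rotAfter a)^[B.length] (Y ++ a :: (A ++ B)) = Y ++ a :: (B ++ A) := by
  induction B using List.reverseRecOn generalizing A with
  | nil => simp
  | append_singleton B b ih =>
    rw [List.length_append, List.length_singleton, Function.iterate_succ_apply,
      ← List.append_assoc, rotAfter_append_concat h]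
    have := ih (b :: A)
    simpa using this

lemma tailLen_rotAfter (a : α) (l : List α) : tailLen a (rotAfter a l) = tailLen a l := by
  by_cases h : a ∈ l
  · obtain ⟨Y, Z, rfl, hY⟩ := List.eq_append_cons_of_mem h
    rw [rotAfter_append hY, tailLen_append hY, tailLen_append hY, List.length_rotate]
  · rw [rotAfter_of_notMem h]

lemma rotAfter_iterate_tailLen (a : α) (l : List α) : (rotAfter a)^[tailLen a l] l = l := by
  by_cases h : a ∈ l
  · obtain ⟨Y, Z, rfl, hY⟩ := List.eq_append_cons_of_mem h
    simpa [tailLen_append hY] using rotAfter_iterate hY [] Z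
  · rw [tailLen_of_notMem h]; rfl

@[simp] lemma move_self (s : Bool) (p : Bool → List α) : move s p s = p s := by
  simp [move]

lemma move_not {s : Bool} {p : Bool → List α} {X : List α} {a : α} (h : p s = X ++ [a]) :
    move s p (!s) = rotAfter a (p (!s)) := by
  simp [move, h]

lemma funext_bool {β : Type*} (s : Bool) {p q : Bool → β} (h : p s = q s)
    (h' : p (!s) = q (!s)) : p = q := by
  funext b
  cases b <;> cases s <;> simp_all

lemma move_perm (s : Bool) (p : Bool → List α) (b : Bool) : (move s p b).Perm (p b) := by
  unfold move
  split
  · rfl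
  · cases (p s).getLast?
    · rfl
    · exact rotAfter_perm _ _

lemma move_nodup {p : Bool → List α} (h : ∀ b, (p b).Nodup) (s b : Bool) :
    (move s p b).Nodup :=
  (move_perm s p b).nodup_iff.2 (h b)

lemma move_iterate_nodup {p : Bool → List α} (h : ∀ b, (p b).Nodup) (s : Bool) (k : ℕ) (b : Bool) :
    ((move s)^[k] p b).Nodup := by
  induction k generalizing b with
  | zero => exact h b
  | succ k ih =>
    rw [Function.iterate_succ_apply']
    exact move_nodup ih s b

lemma move_injective (s : Bool) : Function.Injective (move (α := α) s) := by
  intro p q h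
  have h1 : p s = q s := by simpa using congrFun h s
  refine funext_bool s h1 ?_
  have h2 := congrFun h (!s)
  simp only [move, h1] at h2
  cases hq : (q s).getLast? with
  | none => simpa [hq] using h2
  | some a =>
    simp only [hq, Option.elim] at h2
    exact rotAfter_injective a (by simpa using h2)

lemma period_eq {s : Bool} {p : Bool → List α} {X Y Z : List α} {a : α} (h : p s = X ++ [a])
    (h' : p (!s) = Y ++ a :: Z) (hp : ∀ b, (p b).Nodup) : period s p = Z.length := by
  have := hp (!s)
  rw [h'] at this
  have ha : a ∉ Y := by
    intro hY
    exact (List.nodup_append.1 this).2.2 a hY a (by simp) rfl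
  simp [period, h, h', tailLen_append ha]

lemma period_move (s : Bool) (p : Bool → List α) : period s (move s p) = period s p := by
  simp only [period, move, if_true]
  cases (p s).getLast? <;> simp [tailLen_rotAfter]

lemma period_move_iterate (s : Bool) (p : Bool → List α) (k : ℕ) :
    period s ((move s)^[k] p) = period s p := by
  induction k with
  | zero => rfl
  | succ k ih => rw [Function.iterate_succ_apply', period_move, ih]

lemma move_iterate_self (s : Bool) (p : Bool → List α) (k : ℕ) : (move s)^[k] p s = p s := by
  induction k with
  | zero => rfl
  | succ k ih => rw [Function.iterate_succ_apply', move_self, ih]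

lemma move_iterate_not {s : Bool} {p : Bool → List α} {X : List α} {a : α} (h : p s = X ++ [a])
    (k : ℕ) : (move s)^[k] p (!s) = (rotAfter a)^[k] (p (!s)) := by
  induction k with
  | zero => rfl
  | succ k ih =>
    rw [Function.iterate_succ_apply', move_not ((move_iterate_self s p k).trans h), ih,
      Function.iterate_succ_apply']

lemma move_iterate_period (s : Bool) (p : Bool → List α) : (move s)^[period s p] p = p := by
  refine funext_bool s (move_iterate_self s p _) ?_
  rcases List.eq_nil_or_concat (p s) with h | ⟨X, a, h⟩
  · simp [period, h]
  · rw [List.concat_eq_append] at h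
    rw [move_iterate_not h]
    simpa [period, h] using rotAfter_iterate_tailLen a (p (!s))

lemma move_eq_of_rows {s : Bool} {p q : Bool → List α} {X Y Z : List α} {a b : α}
    (hp : ∀ c, (p c).Nodup) (h : p s = X ++ [a]) (h' : p (!s) = Y ++ a :: (Z ++ [b]))
    (hq : q s = p s) (hq' : q (!s) = Y ++ a :: b :: Z) : move s p = q := by
  have hn := hp (!s)
  rw [h'] at hn
  have ha : a ∉ Y := fun hY => (List.nodup_append.1 hn).2.2 a hY a (by simp) rfl
  refine funext_bool s (by simp [hq]) ?_
  rw [move_not h, h', hq', rotAfter_append_concat ha]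

lemma move_iterate_eq_of_rows {s : Bool} {p q : Bool → List α} {X Y A B : List α} {a : α}
    (hp : ∀ c, (p c).Nodup) (h : p s = X ++ [a]) (h' : p (!s) = Y ++ a :: (A ++ B))
    (hq : q s = p s) (hq' : q (!s) = Y ++ a :: (B ++ A)) {k : ℕ} (hk : k = B.length) :
    (move s)^[k] p = q := by
  have hn := hp (!s)
  rw [h'] at hn
  have ha : a ∉ Y := fun hY => (List.nodup_append.1 hn).2.2 a hY a (by simp) rfl
  refine funext_bool s (by simp [hq, move_iterate_self]) ?_
  rw [move_iterate_not h, h', hq', hk, rotAfter_iterate ha]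

/-! ### Words of moves hanging from a central pair of rows -/

/-- The shape of a pair of rows inside a branch, right after a move of type `s`: row `s` ends with
the reversed list `M` followed by the winner `β`, and row `!s` contains `β` and ends with `M`,
where `M` has `m` letters. -/
def IsBranch (s : Bool) (m : ℕ) (p : Bool → List α) : Prop :=
  ∃ X Y K M β, M.length = m ∧ p (!s) = X ++ β :: (K ++ M) ∧ p s = Y ++ M.reverse ++ [β]

lemma exists_eq_concat_of_length_eq_succ {β : Type*} {M : List β} {m : ℕ} (h : M.length = m + 1) :
    ∃ M' b, M = M' ++ [b] ∧ M'.length = m := by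
  rcases List.eq_nil_or_concat M with rfl | ⟨M', b, rfl⟩
  · simp at h
  · exact ⟨M', b, by simp, by simpa using h⟩

lemma IsBranch.move_same {s : Bool} {m : ℕ} {p : Bool → List α} (h : IsBranch s (m + 1) p)
    (hp : ∀ b, (p b).Nodup) : IsBranch s m (move s p) := by
  obtain ⟨X, Y, K, M, β, hM, h1, h2⟩ := h
  obtain ⟨M, b, rfl, hM'⟩ := exists_eq_concat_of_length_eq_succ hM
  have hmove := move_eq_of_rows (q := fun c => if c = s then p s else X ++ β :: b :: (K ++ M)) hp
    h2 (Y := X) (Z := K ++ M) (b := b) (by simp [h1]) (by simp) (by simp)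
  refine ⟨X, Y ++ [b], b :: K, M, β, hM', ?_, ?_⟩
  · simp [hmove]
  · simp [h2]

lemma IsBranch.move_not {s : Bool} {m : ℕ} {p : Bool → List α} (h : IsBranch s (m + 1) p)
    (hp : ∀ b, (p b).Nodup) : IsBranch (!s) m (move (!s) p) := by
  obtain ⟨X, Y, K, M, β, hM, h1, h2⟩ := h
  obtain ⟨M, b, rfl, hM'⟩ := exists_eq_concat_of_length_eq_succ hM
  have hmove := move_eq_of_rows (s := !s) (X := X ++ β :: (K ++ M)) (a := b)
    (q := fun c => if c = s then Y ++ b :: β :: M.reverse else p (!s)) hp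
    (by simp [h1]) (Y := Y) (Z := M.reverse) (b := β) (by simp [h2]) (by simp) (by simp)
  refine ⟨Y, X ++ β :: K, [β], M.reverse, b, by simpa using hM', ?_, ?_⟩
  · simp [hmove]
  · simp [h1]

lemma IsBranch.period_not {s : Bool} {m : ℕ} {p : Bool → List α} (h : IsBranch s (m + 1) p)
    (hp : ∀ b, (p b).Nodup) : period (!s) p = m + 1 := by
  obtain ⟨X, Y, K, M, β, hM, h1, h2⟩ := h
  obtain ⟨M, b, rfl, hM'⟩ := exists_eq_concat_of_length_eq_succ hM
  rw [period_eq (s := !s) (X := X ++ β :: (K ++ M)) (a := b) (Y := Y) (Z := M.reverse ++ [β])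
    (by simp [h1]) (by simp [h2]) hp]
  simp [hM']

/-- A pair of rows from which all words of at most `N` moves hang freely. -/
structure IsCenter (N : ℕ) (x : Bool → List α) : Prop where
  nodup : ∀ b, (x b).Nodup
  period_eq : ∀ s, period s x = N + 2
  isBranch : ∀ s, IsBranch s N (move s x)

lemma foldr_move_nodup {x : Bool → List α} (h : ∀ b, (x b).Nodup) (w : List Bool) (b : Bool) :
    (w.foldr move x b).Nodup := by
  induction w generalizing b with
  | nil => exact h b
  | cons s w ih => exact move_nodup ih s b

lemma IsCenter.isBranch_foldr {N : ℕ} {x : Bool → List α} (hx : IsCenter N x) (s : Bool)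
    (w : List Bool) (hw : w.length + 1 ≤ N) :
    IsBranch s (N - w.length) ((s :: w).foldr move x) := by
  induction w generalizing s with
  | nil => exact hx.isBranch s
  | cons s' w ih =>
    rw [List.length_cons] at hw
    have h := ih s' (by omega)
    have hn := foldr_move_nodup hx.nodup (s' :: w)
    rw [show N - w.length = N - (s' :: w).length + 1 by simp; omega] at h
    by_cases hs : s = s'
    · subst hs
      exact h.move_same hn
    · obtain rfl : s = !s' := by cases s <;> cases s' <;> simp_all
      exact h.move_not hn

lemma IsCenter.period_not_foldr {N : ℕ} {x : Bool → List α} (hx : IsCenter N x) (s : Bool)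
    (w : List Bool) (hw : w.length + 1 ≤ N) :
    period (!s) ((s :: w).foldr move x) = N - w.length := by
  have h := hx.isBranch_foldr s w hw
  obtain ⟨m, hm⟩ : ∃ m, N - w.length = m + 1 := ⟨N - w.length - 1, by omega⟩
  rw [hm] at h ⊢
  exact h.period_not (foldr_move_nodup hx.nodup _)

lemma IsCenter.lt_period_foldr {N : ℕ} {x : Bool → List α} (hx : IsCenter N x) (s : Bool)
    (w : List Bool) (hw : w.length + 1 ≤ N) :
    N - w.length < period s ((s :: w).foldr move x) := by
  rw [List.foldr_cons, period_move]
  induction w with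
  | nil => simp [hx.period_eq]
  | cons s' w ih =>
    rw [List.length_cons] at hw
    by_cases hs : s = s'
    · subst hs
      rw [List.foldr_cons, period_move]
      have := ih (by omega)
      simp only [List.length_cons]
      omega
    · obtain rfl : s = !s' := by cases s <;> cases s' <;> simp_all
      rw [hx.period_not_foldr s' w (by omega)]
      simp only [List.length_cons]
      omega

lemma IsCenter.period_foldr_le {N : ℕ} {x : Bool → List α} (hx : IsCenter N x) (s : Bool)
    (w : List Bool) (hw : w.length ≤ N) : period s (w.foldr move x) ≤ N + 2 := by
  induction w with
  | nil => simp [hx.period_eq]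
  | cons s' w ih =>
    rw [List.length_cons] at hw
    by_cases hs : s = s'
    · subst hs
      rw [List.foldr_cons, period_move]
      exact ih (by omega)
    · obtain rfl : s = !s' := by cases s <;> cases s' <;> simp_all
      rw [hx.period_not_foldr s' w (by omega)]
      omega

lemma IsCenter.foldr_inj {N N' : ℕ} {x x' : Bool → List α} (hx : IsCenter N x)
    (hx' : IsCenter N' x') {w w' : List Bool} (hw : w.length ≤ N) (hw' : w'.length ≤ N')
    (h : w.foldr move x = w'.foldr move x') : w = w' ∧ x = x' := by
  have key : ∀ {N N' : ℕ} {x x' : Bool → List α}, IsCenter N x → IsCenter N' x' →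
      ∀ (s : Bool) (w : List Bool), w.length + 1 ≤ N → x' ≠ (s :: w).foldr move x := by
    rintro N N' x x' hx hx' s w hw rfl
    have h1 := hx.lt_period_foldr s w hw
    rw [hx'.period_eq, ← hx'.period_eq (!s), hx.period_not_foldr s w hw] at h1
    exact lt_irrefl _ h1
  induction w generalizing w' with
  | nil =>
    cases w' with
    | nil => exact ⟨rfl, h⟩
    | cons s' w' => exact absurd h (key hx' hx s' w' hw')
  | cons s w ih =>
    cases w' with
    | nil => exact absurd h.symm (key hx hx' s w hw)
    | cons s' w' =>
      rw [List.length_cons] at hw hw'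
      by_cases hs : s = s'
      · subst hs
        obtain ⟨rfl, hxx⟩ := ih (w' := w') (by omega) (by omega) (move_injective s h)
        exact ⟨rfl, hxx⟩
      · obtain rfl : s' = !s := by cases s <;> cases s' <;> simp_all
        have h1 := hx.lt_period_foldr s w hw
        have h2 := hx.period_not_foldr s w hw
        have h3 := hx'.lt_period_foldr (!s) w' hw'
        have h4 := hx'.period_not_foldr (!s) w' hw'
        rw [h] at h1 h2
        rw [Bool.not_not] at h4
        omega

lemma exists_eq_replicate_append (s : Bool) (w : List Bool) :
    ∃ i u, w = List.replicate i s ++ u ∧ ∀ s' u', u = s' :: u' → s' = !s := by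
  induction w with
  | nil => exact ⟨0, [], by simp⟩
  | cons a w ih =>
    by_cases h : a = s
    · obtain ⟨i, u, rfl, hu⟩ := ih
      exact ⟨i + 1, u, by simp [h, List.replicate_succ], hu⟩
    · refine ⟨0, a :: w, by simp, ?_⟩
      rintro s' u' h'
      obtain ⟨rfl, -⟩ := List.cons.inj h'
      cases a <;> cases s <;> simp_all

lemma foldr_move_replicate (s : Bool) (i : ℕ) (p : Bool → List α) :
    (List.replicate i s).foldr move p = (move s)^[i] p := by
  induction i with
  | zero => rfl
  | succ i ih => rw [List.replicate_succ, List.foldr_cons, ih, Function.iterate_succ_apply']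

/-- A move applied to a word of maximal length leads to a shorter word or leaves the branches. -/
lemma IsCenter.move_foldr {N : ℕ} {x : Bool → List α} (hx : IsCenter N x) (s : Bool)
    (w : List Bool) (hw : w.length = N) :
    (∃ u : List Bool, u.length ≤ N ∧ move s (w.foldr move x) = u.foldr move x) ∨
      move s (w.foldr move x) = (move s)^[N + 1] x := by
  obtain ⟨i, u, rfl, hu⟩ := exists_eq_replicate_append s w
  rw [List.foldr_append, foldr_move_replicate, ← Function.iterate_succ_apply' (move s)]
  cases u with
  | nil =>
    right
    simp only [List.append_nil, List.length_replicate] at hw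
    rw [hw, List.foldr_nil]
  | cons s' u =>
    left
    obtain rfl := hu s' u rfl
    simp only [List.length_append, List.length_replicate, List.length_cons] at hw
    refine ⟨(!s) :: u, by simp only [List.length_cons]; omega, ?_⟩
    have h := hx.period_not_foldr (!s) u (by omega)
    rw [Bool.not_not] at h
    rw [show i.succ = N - u.length by omega, ← h, move_iterate_period]

/-! ### Standard pairs of rows -/

/-- The standard pair whose row `s` is `z L e y` and whose row `!s` is `y L⁻ e z`, where `L⁻` is the
reversal of `L`. -/
def stdRows (s : Bool) (z y : α) (L : List α) (e : α) : Bool → List α := fun b =>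
  if b = s then z :: (L ++ [e, y]) else y :: (L.reverse ++ [e, z])

/-- The pair whose row `s` is `z P q y Q e` and whose row `!s` is `y P⁻ e z Q⁻ q`. -/
def centerRows (s : Bool) (z y : α) (P : List α) (q : α) (Q : List α) (e : α) : Bool → List α :=
  fun b => if b = s then z :: (P ++ q :: y :: (Q ++ [e]))
    else y :: (P.reverse ++ e :: z :: (Q.reverse ++ [q]))

lemma stdRows_swap (s : Bool) (z y : α) (L : List α) (e : α) :
    stdRows s z y L e = stdRows (!s) y z L.reverse e := by
  refine funext_bool s ?_ ?_ <;> simp [stdRows]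

lemma centerRows_swap (s : Bool) (z y : α) (P : List α) (q : α) (Q : List α) (e : α) :
    centerRows s z y P q Q e = centerRows (!s) y z P.reverse e Q.reverse q := by
  refine funext_bool s ?_ ?_ <;> simp [centerRows]

lemma stdRows_nodup {s : Bool} {z y : α} {L : List α} {e : α} (h : (z :: y :: e :: L).Nodup)
    (b : Bool) : (stdRows s z y L e b).Nodup := by
  have h1 : (z :: (L ++ [e, y])).Nodup := by
    refine (List.Perm.nodup_iff (List.Perm.cons z ?_)).2 h
    exact List.perm_append_comm.trans (List.Perm.swap _ _ _)
  have h2 : (y :: (L.reverse ++ [e, z])).Nodup := by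
    refine (List.Perm.nodup_iff ?_).2 h
    refine List.Perm.trans (List.Perm.cons y ?_) (List.Perm.swap _ _ _)
    refine List.perm_append_comm.trans ?_
    exact (List.Perm.swap _ _ _).trans (((List.reverse_perm L).cons e).cons z)
  unfold stdRows
  split
  · exact h1
  · exact h2

lemma period_stdRows (s : Bool) {z y : α} {L : List α} {e : α} (h : (z :: y :: e :: L).Nodup)
    (t : Bool) : period t (stdRows s z y L e) = L.length + 2 := by
  have key : ∀ (s : Bool) (z y : α) (L : List α), (∀ b, (stdRows s z y L e b).Nodup) →
      period s (stdRows s z y L e) = L.length + 2 := by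
    intro s z y L h
    rw [period_eq (X := z :: (L ++ [e])) (a := y) (Y := []) (Z := L.reverse ++ [e, z])
      (by simp [stdRows]) (by simp [stdRows]) h]
    simp
  by_cases ht : t = s
  · subst ht
    exact key t z y L (stdRows_nodup h)
  · obtain rfl : t = !s := by cases s <;> cases t <;> simp_all
    have h' := stdRows_nodup (s := s) h
    rw [stdRows_swap] at h' ⊢
    rw [key _ _ _ _ h', List.length_reverse]

lemma period_not_move_stdRows (s : Bool) {z y : α} {L : List α} {e : α}
    (h : (z :: y :: e :: L).Nodup) : period (!s) (move s (stdRows s z y L e)) = 1 := by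
  have hn := stdRows_nodup (s := s) h
  have h1 : move s (stdRows s z y L e) =
      fun b => if b = s then z :: (L ++ [e, y]) else y :: z :: (L.reverse ++ [e]) :=
    move_eq_of_rows (X := z :: (L ++ [e])) (a := y) (Y := []) (Z := L.reverse ++ [e]) (b := z) hn
      (by simp [stdRows]) (by simp [stdRows]) (by simp [stdRows]) (by simp)
  have hn' := move_nodup hn s
  rw [h1] at hn' ⊢
  exact period_eq (X := y :: z :: L.reverse) (a := e) (Y := z :: L) (Z := [y]) (by simp) (by simp)
    hn'

lemma move_not_move_iterate_stdRows (s : Bool) {z y : α} {P : List α} {q : α} {Q : List α} {e : α}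
    (h : (z :: y :: e :: (P ++ q :: Q)).Nodup) :
    move (!s) ((move s)^[P.length + 2] (stdRows s z y (P ++ q :: Q) e)) =
      centerRows s z y P q Q e := by
  have hn := stdRows_nodup (s := s) h
  have h1 : (move s)^[P.length + 2] (stdRows s z y (P ++ q :: Q) e) =
      fun b => if b = s then z :: (P ++ q :: (Q ++ [e, y]))
        else y :: (P.reverse ++ e :: z :: (Q.reverse ++ [q])) :=
    move_iterate_eq_of_rows (X := z :: (P ++ q :: (Q ++ [e]))) (a := y) (Y := [])
      (A := Q.reverse ++ [q]) (B := P.reverse ++ [e, z]) hn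
      (by simp [stdRows]) (by simp [stdRows]) (by simp [stdRows]) (by simp) (by simp)
  have hn' := move_iterate_nodup hn s (P.length + 2)
  rw [h1] at hn' ⊢
  exact move_eq_of_rows (X := y :: (P.reverse ++ e :: z :: Q.reverse)) (a := q) (Y := z :: P)
    (Z := Q ++ [e]) (b := y) hn'
    (by simp) (by simp) (by simp [centerRows]) (by simp [centerRows])

lemma isCenter_centerRows (s : Bool) {z y : α} {P : List α} {q : α} {Q : List α} {e : α}
    (h : ∀ b, (centerRows s z y P q Q e b).Nodup) :
    IsCenter Q.length (centerRows s z y P q Q e) := by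
  have key : ∀ (s : Bool) (z y : α) (P : List α) (q : α) (Q : List α) (e : α),
      (∀ b, (centerRows s z y P q Q e b).Nodup) →
      period s (centerRows s z y P q Q e) = Q.length + 2 ∧
      IsBranch s Q.length (move s (centerRows s z y P q Q e)) := by
    intro s z y P q Q e h
    refine ⟨?_, ?_⟩
    · rw [period_eq (X := z :: (P ++ q :: y :: Q)) (a := e) (Y := y :: P.reverse)
        (Z := z :: (Q.reverse ++ [q])) (by simp [centerRows]) (by simp [centerRows]) h]
      simp
    · have h1 : move s (centerRows s z y P q Q e) =
          fun b => if b = s then z :: (P ++ q :: y :: (Q ++ [e]))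
            else y :: (P.reverse ++ e :: q :: z :: Q.reverse) :=
        move_eq_of_rows (X := z :: (P ++ q :: y :: Q)) (a := e) (Y := y :: P.reverse)
          (Z := z :: Q.reverse) (b := q) h (by simp [centerRows]) (by simp [centerRows])
          (by simp [centerRows]) (by simp)
      exact ⟨y :: P.reverse, z :: (P ++ [q, y]), [q, z], Q.reverse, e, by simp, by simp [h1],
        by simp [centerRows]⟩
  have h' := h
  rw [centerRows_swap] at h'
  have k1 := key _ _ _ _ _ _ _ h
  have k2 := key _ _ _ _ _ _ _ h'
  rw [← centerRows_swap, List.length_reverse] at k2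
  refine ⟨h, fun t => ?_, fun t => ?_⟩
  · by_cases ht : t = s
    · exact ht ▸ k1.1
    · obtain rfl : t = !s := by cases s <;> cases t <;> simp_all
      exact k2.1
  · by_cases ht : t = s
    · exact ht ▸ k1.2
    · obtain rfl : t = !s := by cases s <;> cases t <;> simp_all
      exact k2.2

/-! ### The Rauzy class of a standard pair of rows -/

/-- The standard pair of rows whose top row is `z C y`. -/
def base (z y : α) (C : List α) : Bool → List α := fun b =>
  if b then z :: (C ++ [y]) else y :: (C.reverse.rotate 1 ++ [z])

lemma base_concat (z y : α) (L : List α) (e : α) :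
    base z y (L ++ [e]) = stdRows true z y L e := by
  refine funext_bool true ?_ ?_ <;> simp [base, stdRows]

lemma nodup_of_concat {z y : α} {L : List α} {e : α} (h : (z :: y :: (L ++ [e])).Nodup) :
    (z :: y :: e :: L).Nodup :=
  (List.Perm.nodup_iff ((List.perm_append_comm.cons y).cons z)).1 h

/-- The center attached to the cyclic list `C` and the index `k`. -/
def center (z y : α) (C : List α) (k : ℕ) : Bool → List α :=
  move false ((move true)^[k + 2] (base z y C))

lemma exists_eq_append_of_lt_length {β : Type*} {C : List β} {k : ℕ} (hk : k + 2 ≤ C.length) :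
    ∃ P q Q e, C = P ++ q :: Q ++ [e] ∧ P.length = k ∧ Q.length = C.length - (k + 2) := by
  obtain ⟨L, e, rfl, hL⟩ := exists_eq_concat_of_length_eq_succ
    (show C.length = C.length - 1 + 1 by omega)
  simp only [List.length_append, List.length_singleton] at hk
  refine ⟨L.take k, L[k]'(by omega), L.drop (k + 1), e, ?_, ?_, ?_⟩
  · simp
  · rw [List.length_take]; omega
  · simp

lemma base_nodup {z y : α} {C : List α} (hC : (z :: y :: C).Nodup)
    (h0 : C ≠ []) (b : Bool) : (base z y C b).Nodup := by
  rcases List.eq_nil_or_concat C with rfl | ⟨L, e, rfl⟩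
  · exact absurd rfl h0
  · rw [List.concat_eq_append] at hC ⊢
    rw [base_concat]
    exact stdRows_nodup (nodup_of_concat hC) b

lemma period_base {z y : α} {C : List α} (hC : (z :: y :: C).Nodup)
    (h0 : C ≠ []) (s : Bool) : period s (base z y C) = C.length + 1 := by
  rcases List.eq_nil_or_concat C with rfl | ⟨L, e, rfl⟩
  · exact absurd rfl h0
  · rw [List.concat_eq_append] at hC ⊢
    rw [base_concat, period_stdRows _ (nodup_of_concat hC)]
    simp

lemma period_not_move_base {z y : α} {C : List α} (hC : (z :: y :: C).Nodup)
    (h0 : C ≠ []) (s : Bool) :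
    period (!s) (move s (base z y C)) = 1 := by
  rcases List.eq_nil_or_concat C with rfl | ⟨L, e, rfl⟩
  · exact absurd rfl h0
  · rw [List.concat_eq_append] at hC ⊢
    have h := nodup_of_concat hC
    rw [base_concat]
    cases s
    · rw [stdRows_swap]
      refine period_not_move_stdRows false ?_
      refine (List.Perm.nodup_iff ?_).1 h
      exact (List.Perm.swap _ _ _).trans ((((List.reverse_perm L).symm.cons e).cons z).cons y)
    · exact period_not_move_stdRows true h

lemma isCenter_center {z y : α} {C : List α} (hC : (z :: y :: C).Nodup)
    {k : ℕ} (hk : k + 2 ≤ C.length) :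
    IsCenter (C.length - (k + 2)) (center z y C k) := by
  have hn : ∀ b, (center z y C k b).Nodup := move_nodup
    (move_iterate_nodup (base_nodup hC (by rintro rfl; simp at hk)) _ _) _
  obtain ⟨P, q, Q, e, hCe, hP, hQ⟩ := exists_eq_append_of_lt_length hk
  rw [hCe] at hC
  have h : center z y C k = centerRows true z y P q Q e := by
    rw [center, hCe, base_concat, ← hP]
    exact move_not_move_iterate_stdRows true (nodup_of_concat hC)
  rw [h] at hn ⊢
  rw [← hQ]
  exact isCenter_centerRows true hn

lemma move_true_move_iterate_false_base {z y : α} {C : List α} (hC : (z :: y :: C).Nodup)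
    {k : ℕ} (hk : k + 2 ≤ C.length) :
    move true ((move false)^[k + 2] (base z y (C.rotate (k + 1)))) = center z y C k := by
  obtain ⟨P, q, Q, e, rfl, hP, hQ⟩ := exists_eq_append_of_lt_length hk
  have h : center z y (P ++ q :: Q ++ [e]) k = centerRows true z y P q Q e := by
    rw [center, base_concat, ← hP]
    exact move_not_move_iterate_stdRows true (nodup_of_concat hC)
  have hrot : (P ++ q :: Q ++ [e]).rotate (k + 1) = (Q ++ e :: P) ++ [q] := by
    rw [show P ++ q :: Q ++ [e] = (P ++ [q]) ++ (Q ++ [e]) by simp,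
      show k + 1 = (P ++ [q]).length by simp [hP], List.rotate_append_length_eq]
    simp
  have hn : (y :: z :: q :: (P.reverse ++ e :: Q.reverse)).Nodup := by
    refine (List.Perm.nodup_iff ?_).1 hC
    refine (List.Perm.swap _ _ _).trans (List.Perm.cons _ (List.Perm.cons _ ?_))
    simp only [List.append_assoc, List.cons_append]
    refine List.perm_middle.trans (List.Perm.cons _ ?_)
    refine ((List.reverse_perm P).symm.append (List.perm_append_comm (l₂ := [e]))).trans ?_
    exact ((List.reverse_perm Q).symm.cons e).append_left _
  rw [h, hrot, base_concat, stdRows_swap, centerRows_swap]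
  have := move_not_move_iterate_stdRows false hn
  simpa [hP] using this

lemma nodup_rotate {z y : α} {C : List α} (hC : (z :: y :: C).Nodup) (r : ℕ) :
    (z :: y :: C.rotate r).Nodup :=
  (List.Perm.nodup_iff (((List.rotate_perm C r).cons y).cons z)).2 hC

lemma exists_move_not_iterate_base {z y : α} {C : List α} (hC : (z :: y :: C).Nodup) (s : Bool)
    {k : ℕ} (hk : k + 2 ≤ C.length) :
    ∃ r, move (!s) ((move s)^[k + 2] (base z y C)) = center z y (C.rotate r) k := by
  cases s
  · refine ⟨C.length - (k + 1), ?_⟩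
    rw [← move_true_move_iterate_false_base (nodup_rotate hC _) (by simpa using hk),
      List.rotate_rotate, Nat.sub_add_cancel (by omega), List.rotate_length]
    rfl
  · exact ⟨0, by rw [List.rotate_zero]; rfl⟩

lemma period_not_move_iterate_base {z y : α} {C : List α} (hC : (z :: y :: C).Nodup) (s : Bool)
    {j : ℕ} (hj : j < C.length) :
    period (!s) ((move s)^[j + 1] (base z y C)) = if j = 0 then 1 else C.length + 1 - j := by
  have h0 : C ≠ [] := by rintro rfl; simp at hj
  cases j with
  | zero => exact period_not_move_base hC h0 s
  | succ k =>
    obtain ⟨r, hr⟩ := exists_move_not_iterate_base hC s hj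
    rw [← period_move, hr,
      (isCenter_center (nodup_rotate hC r) (by rw [List.length_rotate]; omega)).period_eq,
      List.length_rotate]
    simp only [Nat.add_eq_zero_iff, one_ne_zero, and_false, if_false]
    omega

/-- Indices for the elements of the class that are attached to a given standard pair of rows with
`m + 2` letters. -/
abbrev Index (m : ℕ) : Type :=
  Unit ⊕ (Bool × Fin m) ⊕ (Σ k : Fin (m - 1), Σ l : Fin (m - 1 - k), List.Vector Bool l)

/-- The elements of the class that are attached to the standard pair `base z y C`. -/
def node (z y : α) (C : List α) {m : ℕ} : Index m → Bool → List α
  | .inl _ => base z y C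
  | .inr (.inl (s, j)) => (move s)^[j + 1] (base z y C)
  | .inr (.inr ⟨k, _, w⟩) => w.toList.foldr move (center z y C k)

lemma base_injective (z y : α) : Function.Injective (base z y) := by
  intro C C' h
  simpa [base] using congrFun h true

lemma node_inj {z y : α} {C C' : List α} (hC : (z :: y :: C).Nodup) (hC' : (z :: y :: C').Nodup)
    {m : ℕ} (hm : 1 ≤ m) (hl : C.length = m) (hl' : C'.length = m) {i i' : Index m}
    (h : node z y C i = node z y C' i') : C = C' ∧ i = i' := by
  have ne : ∀ {C : List α}, C.length = m → C ≠ [] := by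
    rintro C hl rfl
    simp at hl
    omega
  have core_lt : ∀ {C : List α}, (z :: y :: C).Nodup → C.length = m → ∀ (s : Bool) (j : Fin m),
      period (!s) ((move s)^[j + 1] (base z y C)) < m + 1 := by
    intro C hC hl s j
    rw [period_not_move_iterate_base hC s (by omega)]
    split <;> omega
  have core_eq : ∀ {C : List α}, (z :: y :: C).Nodup → C.length = m → ∀ (s : Bool) (j : ℕ),
      period s ((move s)^[j] (base z y C)) = m + 1 := by
    intro C hC hl s j
    rw [period_move_iterate, period_base hC (ne hl), hl]
  have word_lt : ∀ {C : List α}, (z :: y :: C).Nodup → C.length = m → ∀ (s : Bool)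
      (k : Fin (m - 1)) (l : Fin (m - 1 - k)) (w : List.Vector Bool l),
      period s (w.toList.foldr move (center z y C k)) < m + 1 := by
    intro C hC hl s k l w
    have := (isCenter_center hC (k := k) (by omega)).period_foldr_le s w.toList
      (by rw [List.Vector.toList_length]; omega)
    omega
  have base_eq : ∀ {C : List α}, (z :: y :: C).Nodup → C.length = m → ∀ s : Bool,
      period s (base z y C) = m + 1 := fun hC hl s => core_eq hC hl s 0
  rcases i with u | ⟨s, j⟩ | ⟨k, l, w⟩ <;> rcases i' with u' | ⟨s', j'⟩ | ⟨k', l', w'⟩ <;>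
    simp only [node] at h
  · exact ⟨base_injective z y h, rfl⟩
  · have := core_lt hC' hl' s' j'
    rw [← h, base_eq hC hl] at this
    omega
  · have := word_lt hC' hl' true k' l' w'
    rw [← h, base_eq hC hl] at this
    omega
  · have := core_lt hC hl s j
    rw [h, base_eq hC' hl'] at this
    omega
  · have hs : s = s' := by
      by_contra hs
      obtain rfl : s' = !s := by cases s <;> cases s' <;> simp_all
      have := core_lt hC hl s j
      rw [h, core_eq hC' hl' (!s)] at this
      omega
    subst hs
    have h1 := congrArg (period (!s)) h
    rw [period_not_move_iterate_base hC s (by omega),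
      period_not_move_iterate_base hC' s (by omega), hl, hl'] at h1
    obtain rfl : j = j' := by
      apply Fin.ext
      split at h1 <;> split at h1 <;> omega
    exact ⟨base_injective z y ((move_injective s).iterate _ h), rfl⟩
  · have := word_lt hC' hl' s k' l' w'
    rw [← h, core_eq hC hl] at this
    omega
  · have := word_lt hC hl true k l w
    rw [h, base_eq hC' hl'] at this
    omega
  · have := word_lt hC hl s' k l w
    rw [h, core_eq hC' hl'] at this
    omega
  · have c := isCenter_center hC (k := k) (by omega)
    have c' := isCenter_center hC' (k := k') (by omega)
    obtain ⟨hw, hx⟩ := c.foldr_inj c' (by rw [List.Vector.toList_length]; omega)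
      (by rw [List.Vector.toList_length]; omega) h
    have h1 := c.period_eq true
    rw [hx, c'.period_eq true] at h1
    obtain rfl : k = k' := by apply Fin.ext; omega
    obtain rfl : l = l' := by
      apply Fin.ext
      rw [← w.toList_length, ← w'.toList_length, hw]
    obtain rfl : w = w' := List.Vector.toList_injective hw
    exact ⟨base_injective z y ((move_injective true).iterate _ (move_injective false hx)), rfl⟩

/-- All elements attached to the rotations of `C`. -/
def rowClass (z y : α) (C : List α) : Set (Bool → List α) :=
  {p | ∃ (r : ℕ) (i : Index C.length), p = node z y (C.rotate r) i}

lemma base_mem_rowClass (z y : α) (C : List α) (r : ℕ) : base z y (C.rotate r) ∈ rowClass z y C :=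
  ⟨r, .inl (), rfl⟩

lemma iterate_mem_rowClass (z y : α) {C : List α} (r : ℕ) (s : Bool) {j : ℕ} (hj : j < C.length) :
    (move s)^[j + 1] (base z y (C.rotate r)) ∈ rowClass z y C :=
  ⟨r, .inr (.inl (s, ⟨j, hj⟩)), rfl⟩

lemma word_mem_rowClass (z y : α) {C : List α} (r : ℕ) {k : ℕ} (hk : k + 2 ≤ C.length)
    (w : List Bool) (hw : w.length ≤ C.length - (k + 2)) :
    w.foldr move (center z y (C.rotate r) k) ∈ rowClass z y C :=
  ⟨r, .inr (.inr ⟨⟨k, by omega⟩, ⟨w.length, by simp only; omega⟩, ⟨w, rfl⟩⟩), rfl⟩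

lemma move_iterate_pred {s : Bool} {p : Bool → List α} {j : ℕ} (hj : period s p = j + 1) :
    (move s)^[j] (move s p) = p := by
  rw [← Function.iterate_succ_apply, Nat.succ_eq_add_one, ← hj, move_iterate_period]

lemma move_mem_rowClass {z y : α} {C : List α} (hC : (z :: y :: C).Nodup) (h0 : C ≠ [])
    {p : Bool → List α} (hp : p ∈ rowClass z y C) (s : Bool) : move s p ∈ rowClass z y C := by
  have hpos := List.length_pos_iff.2 h0
  obtain ⟨r, i, rfl⟩ := hp
  have hCr := nodup_rotate hC r
  have h0r : C.rotate r ≠ [] := by simpa using h0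
  rcases i with u | ⟨t, j⟩ | ⟨k, l, w⟩
  · exact iterate_mem_rowClass z y r s (j := 0) hpos
  · simp only [node]
    by_cases ht : s = t
    · subst ht
      rw [← Function.iterate_succ_apply' (move s)]
      rcases Nat.lt_or_ge (j + 1) C.length with hj | hj
      · exact iterate_mem_rowClass z y r s hj
      · rw [show ((j : ℕ) + 1).succ = period s (base z y (C.rotate r)) by
          rw [period_base hCr h0r, List.length_rotate]; omega, move_iterate_period]
        exact base_mem_rowClass z y C r
    · obtain rfl : s = !t := by cases s <;> cases t <;> simp_all
      obtain ⟨j, hj⟩ := j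
      cases j with
      | zero =>
        have h := move_iterate_pred (period_not_move_base hCr h0r t)
        rw [Function.iterate_zero_apply] at h
        simp only [zero_add, Function.iterate_one, h]
        exact iterate_mem_rowClass z y r t (j := 0) hpos
      | succ k =>
        obtain ⟨r', hr'⟩ := exists_move_not_iterate_base hCr t (k := k)
          (by rw [List.length_rotate]; omega)
        simp only [hr', List.rotate_rotate]
        exact word_mem_rowClass z y _ (by omega) [] (by simp)
  · simp only [node]
    have hk : (k : ℕ) + 2 ≤ C.length := by omega
    have hwl := w.toList_length
    have hc := isCenter_center hCr (k := k) (by simpa using hk)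
    rw [List.length_rotate] at hc
    rcases Nat.lt_or_ge w.toList.length (C.length - (k + 2)) with hl | hl
    · exact word_mem_rowClass z y r hk (s :: w.toList) (by rw [List.length_cons]; omega)
    · rcases hc.move_foldr s w.toList (by omega) with ⟨u, hu, h⟩ | h
      · rw [h]
        exact word_mem_rowClass z y r hk u hu
      · rw [h]
        obtain ⟨r', hr'⟩ : ∃ r', move s ((move (!s))^[(k : ℕ) + 2] (base z y (C.rotate r'))) =
            center z y (C.rotate r) k := by
          cases s
          · exact ⟨r, rfl⟩
          · refine ⟨r + (k + 1), ?_⟩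
            rw [← List.rotate_rotate]
            exact move_true_move_iterate_false_base hCr (by simpa using hk)
        have h1 := hc.period_eq s
        rw [← hr', period_move] at h1
        rw [← hr', move_iterate_pred h1]
        exact iterate_mem_rowClass z y r' (!s) (j := k + 1) (by omega)

/-- Reachability by moves. -/
abbrev Reaches : (Bool → List α) → (Bool → List α) → Prop :=
  Relation.ReflTransGen fun p q => ∃ s, q = move s p

lemma reaches_iterate (s : Bool) (p : Bool → List α) (k : ℕ) : Reaches p ((move s)^[k] p) := by
  induction k with
  | zero => exact .refl
  | succ k ih =>
    rw [Function.iterate_succ_apply']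
    exact ih.tail ⟨s, rfl⟩

lemma reaches_foldr (p : Bool → List α) (w : List Bool) : Reaches p (w.foldr move p) := by
  induction w with
  | nil => exact .refl
  | cons s w ih => exact ih.tail ⟨s, rfl⟩

lemma reaches_center (z y : α) (C : List α) (k : ℕ) : Reaches (base z y C) (center z y C k) :=
  (reaches_iterate true _ _).tail ⟨false, rfl⟩

lemma reaches_base_rotate_one {z y : α} {C : List α} (hC : (z :: y :: C).Nodup) (h0 : C ≠ []) :
    Reaches (base z y C) (base z y (C.rotate 1)) := by
  have hpos := List.length_pos_iff.2 h0
  by_cases h1 : C.length = 1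
  · rw [← h1, List.rotate_length]
  · have hk : 0 + 2 ≤ C.length := by omega
    have hm := move_true_move_iterate_false_base hC hk
    have hp := (isCenter_center hC hk).period_eq true
    rw [← hm, period_move] at hp
    refine (reaches_center z y C 0).trans ?_
    rw [← hm]
    have e1 := reaches_iterate true
      (move true ((move false)^[0 + 2] (base z y (C.rotate (0 + 1))))) (C.length - (0 + 2) + 1)
    rw [move_iterate_pred hp] at e1
    refine e1.trans ?_
    have e2 := reaches_iterate false ((move false)^[0 + 2] (base z y (C.rotate (0 + 1))))
      (C.length - 1)
    rwa [← Function.iterate_add_apply, show C.length - 1 + (0 + 2) =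
      period false (base z y (C.rotate (0 + 1))) by
        rw [period_base (nodup_rotate hC _) (by simpa using h0), List.length_rotate]; omega,
      move_iterate_period] at e2

lemma setOf_reaches_base {z y : α} {C : List α} (hC : (z :: y :: C).Nodup) (h0 : C ≠ []) :
    {p | Reaches (base z y C) p} = rowClass z y C := by
  apply Set.Subset.antisymm
  · intro p hp
    induction hp with
    | refl => simpa using base_mem_rowClass z y C 0
    | tail _ h ih =>
      obtain ⟨s, rfl⟩ := h
      exact move_mem_rowClass hC h0 ih s
  · rintro p ⟨r, i, rfl⟩
    have hr : Reaches (base z y C) (base z y (C.rotate r)) := by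
      induction r with
      | zero => simpa using Relation.ReflTransGen.refl
      | succ r ih =>
        rw [← List.rotate_rotate]
        exact ih.trans (reaches_base_rotate_one (nodup_rotate hC r) (by simpa using h0))
    rcases i with u | ⟨s, j⟩ | ⟨k, l, w⟩
    · exact hr
    · exact hr.trans (reaches_iterate _ _ _)
    · exact (hr.trans (reaches_center _ _ _ _)).trans (reaches_foldr _ _)

lemma card_index (m : ℕ) (hm : 1 ≤ m) : Fintype.card (Index m) = 2 ^ m + m := by
  have h1 : ∀ N : ℕ, ∑ l : Fin N, 2 ^ (l : ℕ) = 2 ^ N - 1 := by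
    intro N
    rw [Fin.sum_univ_eq_sum_range (fun l => 2 ^ l), Nat.geomSum_eq le_rfl]
    simp
  have h2 : ∀ N : ℕ, ∑ k ∈ Finset.range N, (2 ^ (N - k) - 1) + N + 2 = 2 ^ (N + 1) := by
    intro N
    induction N with
    | zero => simp
    | succ N ih =>
      rw [Finset.sum_range_succ']
      simp only [Nat.add_sub_add_right, Nat.sub_zero]
      have := Nat.one_le_two_pow (n := N + 1)
      rw [pow_succ 2 (N + 1)]
      omega
  obtain ⟨N, rfl⟩ : ∃ N, m = N + 1 := ⟨m - 1, by omega⟩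
  simp only [Fintype.card_sum, Fintype.card_unit, Fintype.card_prod, Fintype.card_bool,
    Fintype.card_fin, Fintype.card_sigma, card_vector, h1, Nat.add_sub_cancel]
  rw [Fin.sum_univ_eq_sum_range (fun k => 2 ^ (N - k) - 1), Nat.add_sub_cancel]
  have := h2 N
  omega

lemma rowClass_finite_and_ncard {z y : α} {C : List α} (hC : (z :: y :: C).Nodup) (h0 : C ≠ []) :
    (rowClass z y C).Finite ∧
      (rowClass z y C).ncard = C.length * (2 ^ C.length + C.length) := by
  have hpos := List.length_pos_iff.2 h0
  let f : Fin C.length × Index C.length → Bool → List α := fun x => node z y (C.rotate x.1) x.2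
  have hf : Function.Injective f := by
    rintro ⟨r, i⟩ ⟨r', i'⟩ h
    obtain ⟨h1, rfl⟩ := node_inj (nodup_rotate hC r) (nodup_rotate hC r') hpos (by simp) (by simp) h
    have hn : C.Nodup := hC.of_cons.of_cons
    have h2 := hn.rotate_congr h0 _ _ h1
    rw [Nat.mod_eq_of_lt r.2, Nat.mod_eq_of_lt r'.2] at h2
    rw [Fin.ext h2]
  have hrange : rowClass z y C = Set.range f := by
    apply Set.Subset.antisymm
    · rintro p ⟨r, i, rfl⟩
      exact ⟨(⟨r % C.length, Nat.mod_lt _ hpos⟩, i), by simp [f, List.rotate_mod]⟩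
    · rintro p ⟨⟨r, i⟩, rfl⟩
      exact ⟨r, i, rfl⟩
  rw [hrange]
  refine ⟨Set.finite_range f, ?_⟩
  rw [← Set.image_univ, Set.ncard_image_of_injective _ hf, Set.ncard_univ, Nat.card_eq_fintype_card,
    Fintype.card_prod, Fintype.card_fin, card_index _ hpos]

/-! ### Labeled permutations as pairs of rows -/

/-- The two rows of a labeled permutation. -/
def rows {A : Type*} {d : ℕ} (p : (A ≃ Fin d) × (A ≃ Fin d)) : Bool → List A := fun b =>
  if b then List.ofFn p.1.symm else List.ofFn p.2.symm

lemma rows_injective {A : Type*} {d : ℕ} : Function.Injective (rows (A := A) (d := d)) := by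
  rintro ⟨t, b⟩ ⟨t', b'⟩ h
  have h1 : List.ofFn t.symm = List.ofFn t'.symm := congrFun h true
  have h2 : List.ofFn b.symm = List.ofFn b'.symm := congrFun h false
  have e1 : t.symm = t'.symm := DFunLike.coe_injective (List.ofFn_injective h1)
  have e2 : b.symm = b'.symm := DFunLike.coe_injective (List.ofFn_injective h2)
  rw [← t.symm_symm, ← b.symm_symm, e1, e2]
  rfl

lemma getElem?_rotAfter {a : α} {Y : List α} (h : a ∉ Y) (Z : List α) {j : ℕ}
    (hj : j < (Y ++ a :: Z).length) :
    (rotAfter a (Y ++ a :: Z))[j]? = if j ≤ Y.length then (Y ++ a :: Z)[j]? else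
      if j = Y.length + 1 then (Y ++ a :: Z)[(Y ++ a :: Z).length - 1]? else
        (Y ++ a :: Z)[j - 1]? := by
  rcases List.eq_nil_or_concat Z with rfl | ⟨Z, b, rfl⟩
  · rw [rotAfter_append h]
    grind
  · rw [List.concat_eq_append, rotAfter_append_concat h]
    grind

lemma getElem?_rotAfter_ofFn {N : ℕ} (f : Fin (N + 1) ≃ α) (a : α) (j : Fin (N + 1)) :
    (rotAfter a (List.ofFn f))[(j : ℕ)]? = if (j : ℕ) ≤ (f.symm a : ℕ) then some (f j) else
      if (j : ℕ) = (f.symm a : ℕ) + 1 then some (f (Fin.last N)) else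
        some (f ⟨j - 1, by omega⟩) := by
  have hlen : (List.ofFn f).length = N + 1 := by simp
  have hk : (f.symm a : ℕ) < (List.ofFn f).length := by rw [hlen]; exact (f.symm a).2
  have hsplit : List.ofFn f = (List.ofFn f).take (f.symm a) ++ a ::
      (List.ofFn f).drop (f.symm a + 1) := by
    conv_lhs => rw [← List.take_append_drop (f.symm a) (List.ofFn f),
      List.drop_eq_getElem_cons hk]
    simp [-List.ofFn_succ]
  have ha : a ∉ (List.ofFn f).take (f.symm a) := by
    have hn : (List.ofFn f).Nodup := List.nodup_ofFn.2 f.injective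
    rw [hsplit] at hn
    exact fun hY => (List.nodup_append.1 hn).2.2 a hY a (by simp) rfl
  have key := getElem?_rotAfter ha ((List.ofFn f).drop (f.symm a + 1)) (j := j)
    (by rw [← hsplit, hlen]; exact j.2)
  rw [← hsplit, List.length_take, min_eq_left hk.le, hlen] at key
  rw [key]
  have h2 : (j : ℕ) - 1 < N + 1 := by omega
  simp [-List.ofFn_succ, h2, Fin.last, Nat.le_of_lt_succ j.2]

lemma rotAfter_ofFn_eq_iff {N : ℕ} (f g : Fin (N + 1) ≃ α) (a : α) :
    rotAfter a (List.ofFn f) = List.ofFn g ↔ ∀ j : Fin (N + 1),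
      ((j : ℕ) ≤ (f.symm a : ℕ) → g j = f j) ∧
      ((j : ℕ) = (f.symm a : ℕ) + 1 → g j = f (Fin.last N)) ∧
      ((f.symm a : ℕ) + 1 < (j : ℕ) → ∀ i : Fin (N + 1), (i : ℕ) + 1 = (j : ℕ) → g j = f i) := by
  have hg : ∀ j : Fin (N + 1), (List.ofFn g)[(j : ℕ)]? = some (g j) := by
    intro j
    simp [-List.ofFn_succ, Nat.le_of_lt_succ j.2]
  constructor
  · intro h j
    have hj := hg j
    rw [← h, getElem?_rotAfter_ofFn] at hj
    refine ⟨fun h1 => ?_, fun h1 => ?_, fun h1 i hi => ?_⟩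
    · rw [if_pos h1] at hj
      exact (Option.some.inj hj).symm
    · rw [if_neg (by omega), if_pos h1] at hj
      exact (Option.some.inj hj).symm
    · rw [if_neg (by omega), if_neg (by omega)] at hj
      rw [← Option.some.inj hj]
      congr 1
      apply Fin.ext
      simp only
      omega
  · intro h
    apply List.ext_getElem?
    intro j
    rcases Nat.lt_or_ge j (N + 1) with hj | hj
    · rw [getElem?_rotAfter_ofFn f a ⟨j, hj⟩, hg ⟨j, hj⟩]
      obtain ⟨h1, h2, h3⟩ := h ⟨j, hj⟩
      simp only at h1 h2 h3
      split_ifs with c1 c2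
      · rw [h1 c1]
      · rw [h2 c2]
      · have c3 : ¬ j ≤ (f.symm a : ℕ) := c1
        have c4 : ¬ j = (f.symm a : ℕ) + 1 := c2
        have c5 : (f.symm a : ℕ) + 1 < j := by omega
        rw [h3 c5 ⟨j - 1, by omega⟩ (Nat.sub_add_cancel (by omega))]
    · rw [List.getElem?_eq_none (by rw [(rotAfter_perm _ _).length_eq]; simpa [-List.ofFn_succ] using hj),
        List.getElem?_eq_none (by simpa [-List.ofFn_succ] using hj)]

lemma getLast?_ofFn {β : Type*} {N : ℕ} (f : Fin (N + 1) → β) :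
    (List.ofFn f).getLast? = some (f (Fin.last N)) := by
  rw [List.getLast?_eq_getElem?]
  simp [-List.ofFn_succ, Fin.last]

lemma labStepT_iff {N : ℕ} (p p' : (α ≃ Fin (N + 1)) × (α ≃ Fin (N + 1))) :
    labStepT p p' ↔ p.1.symm (Fin.last N) ≠ p.2.symm (Fin.last N) ∧
      rows p' = move true (rows p) := by
  have hmove : rows p' = move true (rows p) ↔ p'.1 = p.1 ∧
      rotAfter (p.1.symm (Fin.last N)) (List.ofFn p.2.symm) = List.ofFn p'.2.symm := by
    constructor
    · intro h
      have h1 : List.ofFn p'.1.symm = List.ofFn p.1.symm := by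
        simpa [-List.ofFn_succ, rows, move] using congrFun h true
      have h2 : List.ofFn p'.2.symm =
          rotAfter (p.1.symm (Fin.last N)) (List.ofFn p.2.symm) := by
        simpa [-List.ofFn_succ, rows, move, getLast?_ofFn] using congrFun h false
      exact ⟨Equiv.symm_bijective.injective (DFunLike.coe_injective (List.ofFn_injective h1)),
        h2.symm⟩
    · rintro ⟨h1, h2⟩
      refine funext_bool true ?_ ?_
      · simp [-List.ofFn_succ, rows, move, h1]
      · simp [-List.ofFn_succ, rows, move, getLast?_ofFn, h2]
  rw [hmove, rotAfter_ofFn_eq_iff]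
  constructor
  · intro h
    exact h (Fin.last N) (by simp)
  · intro h last hlast
    obtain rfl : last = Fin.last N := Fin.ext (by simp only [Fin.val_last]; omega)
    exact h

lemma labStepB_iff_labStepT_swap {A : Type*} {d : ℕ} (p p' : (A ≃ Fin d) × (A ≃ Fin d)) :
    labStepB p p' ↔ labStepT p.swap p'.swap := by
  simp only [labStepB, labStepT, Prod.fst_swap, Prod.snd_swap, ne_comm]

lemma rows_swap {A : Type*} {d : ℕ} (p : (A ≃ Fin d) × (A ≃ Fin d)) :
    rows p.swap = rows p ∘ not := by
  refine funext_bool true ?_ ?_ <;> simp [rows]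

lemma move_comp_not (s : Bool) (p : Bool → List α) :
    move s (p ∘ not) = move (!s) p ∘ not := by
  funext b
  cases b <;> cases s <;> simp [move]

lemma labStepB_iff {N : ℕ} (p p' : (α ≃ Fin (N + 1)) × (α ≃ Fin (N + 1))) :
    labStepB p p' ↔ p.1.symm (Fin.last N) ≠ p.2.symm (Fin.last N) ∧
      rows p' = move false (rows p) := by
  rw [labStepB_iff_labStepT_swap, labStepT_iff, rows_swap, rows_swap, move_comp_not, ne_comm]
  have hinj : Function.Injective fun q : Bool → List α => q ∘ not :=
    Bool.involutive_not.surjective.injective_comp_right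
  exact and_congr_right fun _ => hinj.eq_iff

/-- The two kinds of labeled Rauzy moves, expressed on rows. -/
lemma labStep_iff {N : ℕ} (p p' : (α ≃ Fin (N + 1)) × (α ≃ Fin (N + 1))) :
    labStepT p p' ∨ labStepB p p' ↔ p.1.symm (Fin.last N) ≠ p.2.symm (Fin.last N) ∧
      ∃ s, rows p' = move s (rows p) := by
  rw [labStepT_iff, labStepB_iff, ← and_or_left, Bool.exists_bool, or_comm]

lemma exists_equiv_ofFn_symm_eq {N : ℕ} {l : List α} (f : Fin (N + 1) ≃ α)
    (h : l.Perm (List.ofFn f)) : ∃ e : α ≃ Fin (N + 1), List.ofFn e.symm = l := by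
  have hl : l.length = N + 1 := by simpa using h.length_eq
  have hn : l.Nodup := h.nodup_iff.2 (List.nodup_ofFn.2 f.injective)
  let g : Fin (N + 1) → α := fun i => l.get (i.cast hl.symm)
  have hg : Function.Injective g := fun i j hij =>
    Fin.cast_injective _ (List.nodup_iff_injective_get.1 hn hij)
  have hb : Function.Bijective g := by
    have : Function.Bijective (f.symm ∘ g) :=
      Finite.injective_iff_bijective.1 (f.symm.injective.comp hg)
    exact (Equiv.comp_bijective g f.symm).1 this
  refine ⟨(Equiv.ofBijective g hb).symm, ?_⟩
  rw [Equiv.symm_symm]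
  apply List.ext_getElem
  · simp [hl]
  · intro i h1 h2
    simp [-List.ofFn_succ, g]

lemma exists_rows_eq_move {N : ℕ} (s : Bool) (p : (α ≃ Fin (N + 1)) × (α ≃ Fin (N + 1))) :
    ∃ p' : (α ≃ Fin (N + 1)) × (α ≃ Fin (N + 1)), rows p' = move s (rows p) := by
  obtain ⟨t, ht⟩ := exists_equiv_ofFn_symm_eq p.1.symm (move_perm s (rows p) true)
  obtain ⟨b, hb⟩ := exists_equiv_ofFn_symm_eq p.2.symm (move_perm s (rows p) false)
  exact ⟨(t, b), funext_bool true ht hb⟩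

lemma rows_nodup {A : Type*} {d : ℕ} (p : (A ≃ Fin d) × (A ≃ Fin d)) (b : Bool) :
    (rows p b).Nodup := by
  cases b
  · exact List.nodup_ofFn.2 p.2.symm.injective
  · exact List.nodup_ofFn.2 p.1.symm.injective

lemma move_rows_of_last_eq {N : ℕ} (s : Bool) (p : (α ≃ Fin (N + 1)) × (α ≃ Fin (N + 1)))
    (h : p.1.symm (Fin.last N) = p.2.symm (Fin.last N)) : move s (rows p) = rows p := by
  have hlast : ∀ b, (rows p b).getLast? = some (p.1.symm (Fin.last N)) := by
    intro b
    cases b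
    · simp [-List.ofFn_succ, rows, getLast?_ofFn, h]
    · simp [-List.ofFn_succ, rows, getLast?_ofFn]
  obtain ⟨X, hX⟩ := List.getLast?_eq_some_iff.1 (hlast s)
  obtain ⟨Y, hY⟩ := List.getLast?_eq_some_iff.1 (hlast !s)
  have hn := rows_nodup p (!s)
  rw [hY] at hn
  refine funext_bool s (move_self _ _) ?_
  rw [move_not hX, hY, rotAfter_append]
  · simp
  · exact fun h => (List.nodup_append.1 hn).2.2 _ h _ (by simp) rfl

lemma rows_image_labRauzyClass {N : ℕ} (p : (α ≃ Fin (N + 1)) × (α ≃ Fin (N + 1))) :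
    rows '' labRauzyClass p = {q | Reaches (rows p) q} := by
  apply Set.Subset.antisymm
  · rintro _ ⟨q, hq, rfl⟩
    exact Relation.ReflTransGen.lift rows (fun a b hab => ((labStep_iff a b).1 hab).2) p q hq
  · intro q hq
    induction hq with
    | refl => exact ⟨p, .refl, rfl⟩
    | tail _ h ih =>
      obtain ⟨a, ha, rfl⟩ := ih
      obtain ⟨s, rfl⟩ := h
      by_cases hl : a.1.symm (Fin.last N) = a.2.symm (Fin.last N)
      · exact ⟨a, ha, (move_rows_of_last_eq s a hl).symm⟩
      · obtain ⟨b, hb⟩ := exists_rows_eq_move s a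
        exact ⟨b, ha.tail ((labStep_iff a b).2 ⟨hl, s, hb⟩), hb⟩

lemma labRauzyClass_finite_and_ncard {N : ℕ} {p : (α ≃ Fin (N + 1)) × (α ≃ Fin (N + 1))}
    {z y : α} {C : List α} (h0 : C ≠ []) (hp : rows p = base z y C) :
    (labRauzyClass p).Finite ∧
      (labRauzyClass p).ncard = C.length * (2 ^ C.length + C.length) := by
  have hC : (z :: y :: C).Nodup := by
    have := rows_nodup p true
    rw [hp] at this
    exact (List.Perm.nodup_iff (List.Perm.cons z (List.perm_append_comm (l₁ := [y])))).2 this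
  have himage := rows_image_labRauzyClass p
  rw [hp, setOf_reaches_base hC h0] at himage
  obtain ⟨h1, h2⟩ := rowClass_finite_and_ncard hC h0
  rw [← himage] at h1 h2
  rw [Set.ncard_image_of_injective _ rows_injective] at h2
  exact ⟨h1.of_finite_image rows_injective.injOn, h2⟩

lemma ofFn_symm_eq {A : Type*} {d : ℕ} (e : A ≃ Fin d) (l : List A) (hl : l.length = d)
    (h : ∀ (i : ℕ) (hi : i < l.length), (e l[i] : ℕ) = i) : List.ofFn e.symm = l := by
  apply List.ext_getElem
  · simp [hl]
  · intro i h1 h2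
    rw [List.getElem_ofFn, Equiv.symm_apply_eq]
    exact Fin.ext (h i h2).symm

end RauzyRows

/-- For every `n ≥ 2`, the labeled permutation `π̃_n` on the alphabet `{0,…,n}`
(encoded as `Fin (n+1)`) with top row `0, 2, 3, …, n-1, 1, n` and bottom row
`n, n-1, …, 1, 0` — that is (in 1-based positions), `π_t(0) = 1`, `π_t(j) = j` for
`2 ≤ j ≤ n-1`, `π_t(1) = n`, `π_t(n) = n+1`, and `π_b(j) = n+1-j`; positions are
encoded 0-based here — has a labeled Rauzy class that is finite of cardinality
`(2^(n-1) - 1 + n)·(n-1)`. -/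
theorem labRauzyClass_pi_n_card (n : ℕ) (hn : 2 ≤ n)
    (πt πb : Fin (n + 1) ≃ Fin (n + 1))
    (hπt : ∀ a : Fin (n + 1),
      ((a : ℕ) = 0 → (πt a : ℕ) = 0) ∧
      (2 ≤ (a : ℕ) ∧ (a : ℕ) ≤ n - 1 → (πt a : ℕ) = (a : ℕ) - 1) ∧
      ((a : ℕ) = 1 → (πt a : ℕ) = n - 1) ∧
      ((a : ℕ) = n → (πt a : ℕ) = n))
    (hπb : ∀ a : Fin (n + 1), (πb a : ℕ) = n - (a : ℕ)) :
    (labRauzyClass (πt, πb)).Finite ∧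
      (labRauzyClass (πt, πb)).ncard = (2 ^ (n - 1) - 1 + n) * (n - 1) := by
  obtain ⟨m, rfl⟩ : ∃ m, n = m + 2 := ⟨n - 2, by omega⟩
  obtain ⟨L, hL, hLget⟩ : ∃ L : List (Fin (m + 2 + 1)), L.length = m ∧
      ∀ (i : ℕ) (hi : i < L.length), (L[i] : ℕ) = i + 2 :=
    ⟨List.ofFn fun i : Fin m => ⟨i + 2, by omega⟩, by simp, by simp⟩
  have hone : ((1 : Fin (m + 2 + 1)) : ℕ) = 1 := rfl
  have hrows : RauzyRows.rows (πt, πb) = RauzyRows.base 0 (Fin.last (m + 2)) (L ++ [1]) := by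
    rw [RauzyRows.base_concat]
    refine RauzyRows.funext_bool true ?_ ?_
    · change List.ofFn πt.symm = 0 :: (L ++ [1, Fin.last (m + 2)])
      refine RauzyRows.ofFn_symm_eq πt _ (by simp [hL]) fun i hi => ?_
      have hval : (((0 :: (L ++ [1, Fin.last (m + 2)]))[i] : Fin (m + 2 + 1)) : ℕ) =
          if i = 0 then 0 else if i ≤ m then i + 1 else if i = m + 1 then 1 else m + 2 := by
        clear hπt hπb
        grind
      obtain ⟨h1, h2, h3, h4⟩ := hπt ((0 :: (L ++ [1, Fin.last (m + 2)]))[i])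
      have hi' : i ≤ m + 2 := by simpa [hL] using hi
      split_ifs at hval <;> omega
    · change List.ofFn πb.symm = Fin.last (m + 2) :: (L.reverse ++ [1, 0])
      refine RauzyRows.ofFn_symm_eq πb _ (by simp [hL]) fun i hi => ?_
      have hval : (((Fin.last (m + 2) :: (L.reverse ++ [1, 0]))[i] : Fin (m + 2 + 1)) : ℕ) =
          m + 2 - i := by
        clear hπt hπb
        grind
      have hi' : i ≤ m + 2 := by simpa [hL] using hi
      rw [hπb, hval]
      omega
  have h := RauzyRows.labRauzyClass_finite_and_ncard (by simp) hrows
  rw [List.length_append, hL, List.length_singleton] at h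
  refine ⟨h.1, h.2.trans ?_⟩
  have := Nat.one_le_two_pow (n := m + 1)
  rw [show m + 2 - 1 = m + 1 by omega,
    show 2 ^ (m + 1) - 1 + (m + 2) = 2 ^ (m + 1) + (m + 1) by omega, Nat.mul_comm]
end

section
/- Let π̃ = (π_t, π_b) be an irreducible labeled permutation on an alphabet 𝒜 of cardinality d ≥ 2, meaning that for every 1 ≤ k ≤ d−1 one has π_t⁻¹({1,…,k}) ≠ π_b⁻¹({1,…,k}) as subsets of 𝒜. Let R_lab = R_lab(π̃) be its labeled Rauzy class and R = R(red(π̃)) the reduced Rauzy class of its reduction red(π̃) = π_b ∘ π_t⁻¹. Then all fibers of the reduction map red : R_lab → R have the same cardinality; in particular the cardinality of R divides the cardinality of R_lab, and the quotient |R_lab|/|R| equals the common cardinality of the fibers. -/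
/-!
Labeled permutations on an alphabet `A` with `|A| = d` are pairs of bijections
`A ≃ Fin d`; reduced permutations on `d` letters are elements of `Equiv.Perm (Fin d)`.
The position/letter `j ∈ {1,…,d}` corresponds to the index `j - 1 : Fin d`.
The Rauzy moves are encoded as binary relations.  The reduction of a labeled
permutation `(π_t, π_b)` is `π_b ∘ π_t⁻¹`, i.e. `π_t.symm.trans π_b`.
-/

/-- The reduced top Rauzy move `𝓡_t`, as a relation. -/
def redStepT {d : ℕ} (π π' : Equiv.Perm (Fin d)) : Prop :=
  ∀ last : Fin d, (last : ℕ) + 1 = d →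
    (π last : ℕ) + 1 ≠ d ∧
    ∀ i : Fin d, (π' i : ℕ) =
      if (π i : ℕ) ≤ (π last : ℕ) then (π i : ℕ)
      else if (π i : ℕ) + 1 = d then (π last : ℕ) + 1
      else (π i : ℕ) + 1

/-- The reduced bottom Rauzy move `𝓡_b`, as a relation. -/
def redStepB {d : ℕ} (π π' : Equiv.Perm (Fin d)) : Prop :=
  ∀ last : Fin d, (last : ℕ) + 1 = d →
    (π last : ℕ) + 1 ≠ d ∧
    ∀ j : Fin d,
      ((j : ℕ) ≤ (π.symm last : ℕ) → π' j = π j) ∧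
      ((j : ℕ) = (π.symm last : ℕ) + 1 → π' j = π last) ∧
      ((π.symm last : ℕ) + 1 < (j : ℕ) →
        ∀ i : Fin d, (i : ℕ) + 1 = (j : ℕ) → π' j = π i)

/-- The reduction `π_b ∘ π_t⁻¹` of a labeled permutation. -/
def reduction {A : Type*} {d : ℕ} (p : (A ≃ Fin d) × (A ≃ Fin d)) :
    Equiv.Perm (Fin d) :=
  p.1.symm.trans p.2

/-- The reduced Rauzy class of `π`. -/
def redRauzyClass {d : ℕ} (π : Equiv.Perm (Fin d)) : Set (Equiv.Perm (Fin d)) :=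
  {σ | Relation.ReflTransGen (fun a b => redStepT a b ∨ redStepB a b) π σ}

/-- The permutation of `Fin d` fixing `{0,…,k}` and cyclically shifting `{k+1,…,d-1}`
one step up (the identity if `k` is the last index). -/
noncomputable def tailShift {d : ℕ} (k : Fin d) : Equiv.Perm (Fin d) :=
  Equiv.ofBijective
    (fun j : Fin d =>
      if h : (j : ℕ) ≤ (k : ℕ) then j
      else if h' : (j : ℕ) + 1 = d then ⟨(k : ℕ) + 1, by omega⟩
      else ⟨(j : ℕ) + 1, by omega⟩)
    (Finite.injective_iff_bijective.mp (by
      intro a b hab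
      ext
      dsimp only at hab
      split_ifs at hab <;> simp only [Fin.ext_iff] at hab <;> omega))

theorem tailShift_val {d : ℕ} (k j : Fin d) :
    (tailShift k j : ℕ) =
      if (j : ℕ) ≤ (k : ℕ) then (j : ℕ)
      else if (j : ℕ) + 1 = d then (k : ℕ) + 1
      else (j : ℕ) + 1 := by
  simp only [tailShift, Equiv.ofBijective_apply]
  split_ifs <;> rfl

theorem tailShift_self {d : ℕ} (k : Fin d) : tailShift k k = k := by
  ext
  simp [tailShift_val]

/-- The formulas defining a Rauzy move on one row say that the row is composed with
`tailShift k`. -/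
theorem eq_trans_tailShift_iff {A : Type*} {d : ℕ} {last k : Fin d}
    (hlast : (last : ℕ) + 1 = d) (hk : k ≠ last) (e e' : A ≃ Fin d) :
    (∀ j : Fin d,
      ((j : ℕ) ≤ (k : ℕ) → e'.symm j = e.symm j) ∧
      ((j : ℕ) = (k : ℕ) + 1 → e'.symm j = e.symm last) ∧
      ((k : ℕ) + 1 < (j : ℕ) →
        ∀ i : Fin d, (i : ℕ) + 1 = (j : ℕ) → e'.symm j = e.symm i)) ↔
    e' = e.trans (tailShift k) := by
  have hk' : (k : ℕ) ≠ (last : ℕ) := fun h => hk (Fin.ext h)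
  constructor
  · intro h
    ext1 a
    obtain ⟨i, rfl⟩ := e.symm.surjective a
    rw [Equiv.trans_apply, Equiv.apply_symm_apply, ← Equiv.eq_symm_apply]
    have hv := tailShift_val k i
    obtain ⟨h₁, h₂, h₃⟩ := h (tailShift k i)
    split_ifs at hv with hik hid
    · rw [h₁ (by omega), show tailShift k i = i from Fin.ext hv]
    · rw [h₂ hv, show i = last from Fin.ext (by omega)]
    · exact (h₃ (by omega) i hv.symm).symm
  · rintro rfl j
    have key : ∀ i, tailShift k i = j → (e.trans (tailShift k)).symm j = e.symm i := by
      rintro i rfl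
      simp
    refine ⟨fun h => key j (Fin.ext ?_), fun h => key last (Fin.ext ?_),
      fun h i hi => key i (Fin.ext ?_)⟩ <;> rw [tailShift_val] <;> split_ifs <;> omega

theorem forall_last_iff {d : ℕ} {last : Fin d} (hlast : (last : ℕ) + 1 = d)
    (P : Fin d → Prop) : (∀ l : Fin d, (l : ℕ) + 1 = d → P l) ↔ P last := by
  refine ⟨fun h => h last hlast, fun h l hl => ?_⟩
  rwa [show l = last from Fin.ext (by omega)]

theorem redStepT_iff {d : ℕ} {last : Fin d} (hlast : (last : ℕ) + 1 = d)
    (π π' : Equiv.Perm (Fin d)) :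
    redStepT π π' ↔ π last ≠ last ∧ π' = π.trans (tailShift (π last)) := by
  rw [redStepT, forall_last_iff hlast]
  refine and_congr (not_congr ?_) ?_
  · rw [Fin.ext_iff]
    omega
  · simp [Equiv.ext_iff, Fin.ext_iff, tailShift_val]

theorem redStepB_iff {d : ℕ} {last : Fin d} (hlast : (last : ℕ) + 1 = d)
    (π π' : Equiv.Perm (Fin d)) :
    redStepB π π' ↔
      π.symm last ≠ last ∧ π'.symm = π.symm.trans (tailShift (π.symm last)) := by
  rw [redStepB, forall_last_iff hlast]
  have hne : (π last : ℕ) + 1 ≠ d ↔ π.symm last ≠ last := by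
    rw [ne_eq, ne_eq, Equiv.symm_apply_eq, Fin.ext_iff]
    omega
  rw [hne]
  exact and_congr_right fun h => eq_trans_tailShift_iff hlast h π.symm π'.symm

theorem labStepT_iff {A : Type*} {d : ℕ} {last : Fin d} (hlast : (last : ℕ) + 1 = d)
    (p p' : (A ≃ Fin d) × (A ≃ Fin d)) :
    labStepT p p' ↔ p.2 (p.1.symm last) ≠ last ∧
      p' = (p.1, p.2.trans (tailShift (p.2 (p.1.symm last)))) := by
  rw [labStepT, forall_last_iff hlast, ne_eq, Equiv.eq_symm_apply, Prod.ext_iff]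
  exact and_congr_right fun h =>
    and_congr_right fun _ => eq_trans_tailShift_iff hlast h p.2 p'.2

theorem labStepB_iff_labStepT_swap {A : Type*} {d : ℕ} (p p' : (A ≃ Fin d) × (A ≃ Fin d)) :
    labStepB p p' ↔ labStepT p.swap p'.swap := by
  simp only [labStepB, labStepT, Prod.fst_swap, Prod.snd_swap, ne_comm]

theorem reduction_swap {A : Type*} {d : ℕ} (p : (A ≃ Fin d) × (A ≃ Fin d)) :
    reduction p.swap = (reduction p).symm := rfl

theorem redStepB_iff_redStepT_symm {d : ℕ} {last : Fin d} (hlast : (last : ℕ) + 1 = d)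
    (π π' : Equiv.Perm (Fin d)) : redStepB π π' ↔ redStepT π.symm π'.symm := by
  rw [redStepB_iff hlast, redStepT_iff hlast]

theorem redStepT_reduction_iff {A : Type*} {d : ℕ} {last : Fin d}
    (hlast : (last : ℕ) + 1 = d) (p : (A ≃ Fin d) × (A ≃ Fin d)) (σ : Equiv.Perm (Fin d)) :
    redStepT (reduction p) σ ↔ ∃ p', labStepT p p' ∧ reduction p' = σ := by
  simp only [redStepT_iff hlast, labStepT_iff hlast, and_assoc, exists_and_left,
    exists_eq_left]
  exact and_congr_right fun _ => eq_comm

theorem redStepB_reduction_iff {A : Type*} {d : ℕ} {last : Fin d}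
    (hlast : (last : ℕ) + 1 = d) (p : (A ≃ Fin d) × (A ≃ Fin d)) (σ : Equiv.Perm (Fin d)) :
    redStepB (reduction p) σ ↔ ∃ p', labStepB p p' ∧ reduction p' = σ := by
  rw [redStepB_iff_redStepT_symm hlast, ← reduction_swap, redStepT_reduction_iff hlast]
  simp only [labStepB_iff_labStepT_swap]
  constructor
  · rintro ⟨q, hq, h⟩
    exact ⟨q.swap, by simpa using hq, by rw [reduction_swap, h, Equiv.symm_symm]⟩
  · rintro ⟨q, hq, rfl⟩
    exact ⟨q.swap, hq, reduction_swap q⟩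

/-- The top move can be undone by iterating it. -/
theorem reflTransGen_labStepT_of_labStepT {A : Type*} {d : ℕ} {last : Fin d}
    (hlast : (last : ℕ) + 1 = d) {p p' : (A ≃ Fin d) × (A ≃ Fin d)} (h : labStepT p p') :
    Relation.ReflTransGen labStepT p' p := by
  obtain ⟨hne, rfl⟩ := (labStepT_iff hlast _ _).mp h
  set k := p.2 (p.1.symm last) with hk
  have iter : ∀ n : ℕ, Relation.ReflTransGen labStepT (p.1, p.2.trans (tailShift k))
      (p.1, p.2.trans (tailShift k ^ (n + 1))) := by
    intro n
    induction n with
    | zero => simpa using Relation.ReflTransGen.refl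
    | succ n ih =>
      refine ih.tail ((labStepT_iff hlast _ _).mpr ?_)
      have hfix : (tailShift k ^ (n + 1)) k = k :=
        Equiv.Perm.pow_apply_eq_self_of_apply_eq_self (tailShift_self k) _
      simp only [Equiv.trans_apply, ← hk, hfix]
      exact ⟨hne, by rw [pow_succ' _ (n + 1)]; rfl⟩
  have hret := iter (orderOf (tailShift k) - 1)
  rwa [Nat.sub_add_cancel (orderOf_pos _), pow_orderOf_eq_one,
    show p.2.trans (1 : Equiv.Perm (Fin d)) = p.2 from rfl] at hret

theorem labRauzyClass_symm {A : Type*} {d : ℕ} {last : Fin d} (hlast : (last : ℕ) + 1 = d)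
    {p q : (A ≃ Fin d) × (A ≃ Fin d)} (h : q ∈ labRauzyClass p) : p ∈ labRauzyClass q := by
  induction h with
  | refl => exact Relation.ReflTransGen.refl
  | tail _ hstep ih =>
    refine Relation.ReflTransGen.trans ?_ ih
    rcases hstep with hT | hB
    · exact Relation.ReflTransGen.mono (fun _ _ => Or.inl) _ _
        (reflTransGen_labStepT_of_labStepT hlast hT)
    · rw [labStepB_iff_labStepT_swap] at hB
      exact Relation.ReflTransGen.lift Prod.swap
        (fun a b hab => Or.inr ((labStepB_iff_labStepT_swap _ _).mpr (by simpa using hab))) _ _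
        (reflTransGen_labStepT_of_labStepT hlast hB)

theorem reduction_mem_redRauzyClass {A : Type*} {d : ℕ} {last : Fin d}
    (hlast : (last : ℕ) + 1 = d) {p q : (A ≃ Fin d) × (A ≃ Fin d)}
    (h : q ∈ labRauzyClass p) : reduction q ∈ redRauzyClass (reduction p) :=
  Relation.ReflTransGen.lift reduction (fun _ _ hstep => Or.imp
    (fun hT => (redStepT_reduction_iff hlast _ _).mpr ⟨_, hT, rfl⟩)
    (fun hB => (redStepB_reduction_iff hlast _ _).mpr ⟨_, hB, rfl⟩) hstep) _ _ h

theorem exists_mem_labRauzyClass_reduction_eq {A : Type*} {d : ℕ} {last : Fin d}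
    (hlast : (last : ℕ) + 1 = d) {p : (A ≃ Fin d) × (A ≃ Fin d)} {σ : Equiv.Perm (Fin d)}
    (h : σ ∈ redRauzyClass (reduction p)) : ∃ q ∈ labRauzyClass p, reduction q = σ := by
  induction h with
  | refl => exact ⟨p, Relation.ReflTransGen.refl, rfl⟩
  | tail _ hstep ih =>
    obtain ⟨q, hq, rfl⟩ := ih
    rcases hstep with hT | hB
    · obtain ⟨q', hq', rfl⟩ := (redStepT_reduction_iff hlast _ _).mp hT
      exact ⟨q', Relation.ReflTransGen.tail hq (Or.inl hq'), rfl⟩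
    · obtain ⟨q', hq', rfl⟩ := (redStepB_reduction_iff hlast _ _).mp hB
      exact ⟨q', Relation.ReflTransGen.tail hq (Or.inr hq'), rfl⟩

/-- Renaming the letters of a labeled permutation. -/
def renameLetters {A : Type*} {d : ℕ} (τ : Equiv.Perm A) (p : (A ≃ Fin d) × (A ≃ Fin d)) :
    (A ≃ Fin d) × (A ≃ Fin d) :=
  (τ.trans p.1, τ.trans p.2)

theorem renameLetters_injective {A : Type*} {d : ℕ} (p : (A ≃ Fin d) × (A ≃ Fin d)) :
    Function.Injective fun τ : Equiv.Perm A => renameLetters τ p := by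
  intro τ τ' h
  ext a
  exact p.1.injective (congrArg (fun q => q.1 a) h)

theorem reduction_eq_iff_exists_renameLetters {A : Type*} {d : ℕ}
    (p q : (A ≃ Fin d) × (A ≃ Fin d)) :
    reduction q = reduction p ↔ ∃ τ : Equiv.Perm A, renameLetters τ p = q := by
  constructor
  · intro h
    refine ⟨q.1.trans p.1.symm, Prod.ext ?_ ?_⟩
    · ext a
      simp [renameLetters]
    · ext1 a
      have ha := congrArg (fun σ => σ (q.1 a)) h
      simpa [reduction, renameLetters] using ha.symm
  · rintro ⟨τ, rfl⟩
    ext i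
    simp [reduction, renameLetters]

theorem labStepT.renameLetters {A : Type*} {d : ℕ} {last : Fin d} (hlast : (last : ℕ) + 1 = d)
    (τ : Equiv.Perm A) {p p' : (A ≃ Fin d) × (A ≃ Fin d)} (h : labStepT p p') :
    labStepT (renameLetters τ p) (renameLetters τ p') := by
  obtain ⟨hne, rfl⟩ := (labStepT_iff hlast _ _).mp h
  refine (labStepT_iff hlast _ _).mpr ?_
  simpa [_root_.renameLetters, Equiv.trans_assoc] using hne

theorem labStepB.renameLetters {A : Type*} {d : ℕ} {last : Fin d} (hlast : (last : ℕ) + 1 = d)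
    (τ : Equiv.Perm A) {p p' : (A ≃ Fin d) × (A ≃ Fin d)} (h : labStepB p p') :
    labStepB (renameLetters τ p) (renameLetters τ p') := by
  rw [labStepB_iff_labStepT_swap] at h ⊢
  exact h.renameLetters hlast τ

theorem renameLetters_mem_labRauzyClass {A : Type*} {d : ℕ} {last : Fin d}
    (hlast : (last : ℕ) + 1 = d) (τ : Equiv.Perm A) {p q : (A ≃ Fin d) × (A ≃ Fin d)}
    (h : q ∈ labRauzyClass p) : renameLetters τ q ∈ labRauzyClass (renameLetters τ p) :=
  Relation.ReflTransGen.lift (renameLetters τ) (fun _ _ hstep => Or.imp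
    (fun hT => hT.renameLetters hlast τ)
    (fun hB => hB.renameLetters hlast τ) hstep) _ _ h

theorem renameLetters_mem_labRauzyClass_iff {A : Type*} {d : ℕ} {last : Fin d}
    (hlast : (last : ℕ) + 1 = d) (τ : Equiv.Perm A) {p q : (A ≃ Fin d) × (A ≃ Fin d)}
    (h : q ∈ labRauzyClass p) :
    renameLetters τ q ∈ labRauzyClass p ↔ renameLetters τ p ∈ labRauzyClass p :=
  ⟨fun hτ => Relation.ReflTransGen.trans hτ
      (renameLetters_mem_labRauzyClass hlast τ (labRauzyClass_symm hlast h)),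
    fun hτ => Relation.ReflTransGen.trans hτ (renameLetters_mem_labRauzyClass hlast τ h)⟩

theorem ncard_fiber_labRauzyClass {A : Type*} {d : ℕ} {last : Fin d}
    (hlast : (last : ℕ) + 1 = d) {p : (A ≃ Fin d) × (A ≃ Fin d)} {σ : Equiv.Perm (Fin d)}
    (h : σ ∈ redRauzyClass (reduction p)) :
    {q ∈ labRauzyClass p | reduction q = σ}.ncard =
      {τ : Equiv.Perm A | renameLetters τ p ∈ labRauzyClass p}.ncard := by
  obtain ⟨q, hq, rfl⟩ := exists_mem_labRauzyClass_reduction_eq hlast h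
  rw [← Set.ncard_image_of_injective _ (renameLetters_injective q)]
  congr 1
  ext q'
  simp only [Set.mem_ofPred_eq, Set.mem_image, reduction_eq_iff_exists_renameLetters]
  constructor
  · rintro ⟨hq', τ, rfl⟩
    exact ⟨τ, (renameLetters_mem_labRauzyClass_iff hlast τ hq).mp hq', rfl⟩
  · rintro ⟨τ, hτ, rfl⟩
    exact ⟨(renameLetters_mem_labRauzyClass_iff hlast τ hq).mpr hτ, τ, rfl⟩

/-- Let `π̃ = (π_t, π_b)` be an irreducible labeled permutation on an alphabet of
cardinality `d ≥ 2`: for every `1 ≤ k ≤ d-1`, `π_t⁻¹({1,…,k}) ≠ π_b⁻¹({1,…,k})`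
(positions being encoded 0-based, `π_t(a) ∈ {1,…,k}` reads `(π_t a : ℕ) < k`).
Then all fibers of the reduction map `red : R_lab(π̃) → R(red(π̃))` have the same
cardinality `m`; in particular `|R(red(π̃))| · m = |R_lab(π̃)|`, so the cardinality of
the reduced class divides that of the labeled class, with quotient the common fiber
cardinality. -/
theorem labRauzyClass_fibers_card {A : Type*} (d : ℕ) (hd : 2 ≤ d)
    (p : (A ≃ Fin d) × (A ≃ Fin d))
    (hirr : ∀ k : ℕ, 1 ≤ k → k ≤ d - 1 →
      {a : A | (p.1 a : ℕ) < k} ≠ {a : A | (p.2 a : ℕ) < k}) :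
    ∃ m : ℕ,
      (∀ σ ∈ redRauzyClass (reduction p),
        {q ∈ labRauzyClass p | reduction q = σ}.ncard = m) ∧
      (redRauzyClass (reduction p)).ncard * m = (labRauzyClass p).ncard := by
  have hlast : ((⟨d - 1, by omega⟩ : Fin d) : ℕ) + 1 = d := Nat.sub_add_cancel (by omega)
  have hfib := fun σ (hσ : σ ∈ redRauzyClass (reduction p)) => ncard_fiber_labRauzyClass hlast hσ
  refine ⟨_, hfib, ?_⟩
  classical
  have : Finite A := Finite.of_equiv _ p.1.symm
  have hlab : (labRauzyClass p).Finite := by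
    have : Finite (A ≃ Fin d) := Finite.of_injective _ DFunLike.coe_injective
    exact Set.toFinite _
  have hred : (redRauzyClass (reduction p)).Finite := Set.toFinite _
  rw [Set.ncard_eq_toFinset_card _ hlab, Set.ncard_eq_toFinset_card _ hred,
    Finset.card_eq_sum_card_fiberwise (f := reduction) (t := hred.toFinset)
      fun q hq => by simpa using reduction_mem_redRauzyClass hlast (by simpa using hq)]
  refine (Finset.sum_const_nat fun σ hσ => ?_).symm
  rw [← hfib σ (by simpa using hσ), ← Set.ncard_coe_finset]
  congr 1
  ext q
  simp
end
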